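/- (Uniqueness up to a common additive constant for the linearized system.) If (u₁,v₁) and (u₂,v₂) are two classical solutions of the linearized system (P_lin), then there exists a constant s ∈ ℝ such that u₂(x) − u₁(x) = s for all x ∈ [0,L], v₂(x) − v₁(x) = s for all x ∈ [0,L₁], and v₂(x) − v₁(x) = s for all x ∈ [L₁+δ, L]. -/

import Mathlib

open Set MeasureTheory intervalIntegral

/-- The flux term `−(r u′) + ν·(r (ln c)′)` appearing in the electrolyte equation. -/
noncomputable def flux (r c : ℝ → ℝ) (ν : ℝ) (u : ℝ → ℝ) : ℝ → ℝ :=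
  fun y => -(r y * deriv u y) + ν * (r y * deriv c y / c y)

/-- A classical solution `(u, v)` of the system. -/
def IsSolutionLin (L₁ δ L ν dm dp lm lp tm tp : ℝ)
    (f r c bm bp u v : ℝ → ℝ) : Prop :=
  -- `u` is continuously differentiable on `[0, L]`
  ContDiffOn ℝ 1 u (Icc 0 L) ∧
  -- `r·u′` is differentiable on `(0, L)`
  DifferentiableOn ℝ (fun y => r y * deriv u y) (Ioo 0 L) ∧
  -- `v` is twice differentiable on `[0, L₁]` and on `[L₁+δ, L]`
  (∀ x ∈ Icc 0 L₁ ∪ Icc (L₁ + δ) L,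
      DifferentiableAt ℝ v x ∧ DifferentiableAt ℝ (deriv v) x) ∧
  -- electrolyte-potential equation on the negative electrode
  (∀ x ∈ Ioo 0 L₁, deriv (flux r c ν u) x = lm * bm x * (v x - u x - f x)) ∧
  -- electrolyte-potential equation on the separator
  (∀ x ∈ Ioo L₁ (L₁ + δ), deriv (flux r c ν u) x = 0) ∧
  -- electrolyte-potential equation on the positive electrode
  (∀ x ∈ Ioo (L₁ + δ) L, deriv (flux r c ν u) x = lp * bp x * (v x - u x - f x)) ∧
  -- boundary conditions for `u`
  deriv u 0 = 0 ∧ deriv u L = 0 ∧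
  -- solid-potential equation on the negative electrode (`−v″ = −(⋯)`)
  (∀ x ∈ Ioo 0 L₁, deriv (deriv v) x = tm * bm x * (v x - u x - f x)) ∧
  -- solid-potential equation on the positive electrode (`−v″ = −(⋯)`)
  (∀ x ∈ Ioo (L₁ + δ) L, deriv (deriv v) x = tp * bp x * (v x - u x - f x)) ∧
  -- boundary conditions for `v`: `−v′(0) = d₋`, `v′(L) = −d₊`, `v′(L₁) = v′(L₁+δ) = 0`
  deriv v 0 = -dm ∧ deriv v L = -dp ∧ deriv v L₁ = 0 ∧ deriv v (L₁ + δ) = 0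

/-- A function that is continuous on `[a, b]` with zero derivative on `(a, b)` is constant. -/
theorem eq_of_hasDerivAt_zero_Ioo {h : ℝ → ℝ} {a b : ℝ} (hcont : ContinuousOn h (Icc a b))
    (hder : ∀ x ∈ Ioo a b, HasDerivAt h 0 x) : ∀ x ∈ Icc a b, ∀ y ∈ Icc a b, h x = h y := by
  have hd : ∀ x ∈ interior (Icc a b), HasDerivWithinAt h 0 (interior (Icc a b)) x := by
    intro x hx
    rw [interior_Icc] at hx ⊢
    exact (hder x hx).hasDerivWithinAt
  have hmono : MonotoneOn h (Icc a b) :=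
    monotoneOn_of_hasDerivWithinAt_nonneg (convex_Icc a b) hcont hd fun _ _ => le_rfl
  have hanti : AntitoneOn h (Icc a b) :=
    antitoneOn_of_hasDerivWithinAt_nonpos (convex_Icc a b) hcont hd fun _ _ => le_rfl
  intro x hx y hy
  rcases le_total x y with hxy | hxy
  · exact le_antisymm (hmono hx hy hxy) (hanti hx hy hxy)
  · exact le_antisymm (hanti hy hx hxy) (hmono hy hx hxy)

/-- Solutions of `y' = β g`, `r g' = (r + κ) y` with `y = 0` at both ends vanish identically. -/
theorem electrode_eq_zero {a b κ : ℝ} {r β g y : ℝ → ℝ} (hab : a < b) (hκ : 0 < κ)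
    (hr : ∀ x ∈ Icc a b, 0 < r x) (hβ : ∀ x ∈ Icc a b, 0 < β x)
    (hg : ContinuousOn g (Icc a b)) (hy : ContinuousOn y (Icc a b))
    (hy' : ∀ x ∈ Ioo a b, HasDerivAt y (β x * g x) x)
    (hg' : ∀ x ∈ Ioo a b, HasDerivAt g (((r x + κ) * y x) / r x) x)
    (hya : y a = 0) (hyb : y b = 0) :
    ∀ x ∈ Icc a b, g x = 0 ∧ y x = 0 := by
  have hder : ∀ x ∈ Ioo a b,
      HasDerivAt (fun x => g x * y x) ((r x + κ) / r x * y x ^ 2 + β x * g x ^ 2) x := by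
    intro x hx
    refine HasDerivAt.congr_deriv ((hg' x hx).fun_mul (hy' x hx)) ?_
    ring
  have hmono : MonotoneOn (fun x => g x * y x) (Icc a b) := by
    refine monotoneOn_of_hasDerivWithinAt_nonneg (convex_Icc a b) (hg.mul hy)
      (f' := fun x => (r x + κ) / r x * y x ^ 2 + β x * g x ^ 2) ?_ ?_
    · intro x hx
      rw [interior_Icc] at hx
      exact (hder x hx).hasDerivWithinAt
    · intro x hx
      have hx' := interior_subset hx
      have := hr x hx'
      have := hβ x hx'
      positivity
  have hzero : ∀ x ∈ Icc a b, g x * y x = 0 := by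
    intro x hx
    have h1 := hmono (left_mem_Icc.2 hab.le) hx hx.1
    have h2 := hmono hx (right_mem_Icc.2 hab.le) hx.2
    simp only [hya, hyb, mul_zero] at h1 h2
    exact le_antisymm h2 h1
  have hint : ∀ x ∈ Ioo a b, g x = 0 ∧ y x = 0 := by
    intro x hx
    have h0 : HasDerivAt (fun x => g x * y x) 0 x := by
      refine (hasDerivAt_const x (0 : ℝ)).congr_of_eventuallyEq ?_
      filter_upwards [isOpen_Ioo.mem_nhds hx] with t ht
      exact hzero t (Ioo_subset_Icc_self ht)
    have he := (hder x hx).unique h0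
    have hrx := hr x (Ioo_subset_Icc_self hx)
    have hβx := hβ x (Ioo_subset_Icc_self hx)
    have h1 : 0 ≤ (r x + κ) / r x * y x ^ 2 := by positivity
    have h2 : 0 ≤ β x * g x ^ 2 := by positivity
    have h3 : β x * g x ^ 2 = 0 := by linarith
    have h4 : (r x + κ) / r x * y x ^ 2 = 0 := by linarith
    have h5 : (r x + κ) / r x ≠ 0 := by positivity
    constructor
    · simpa [hβx.ne'] using h3
    · exact pow_eq_zero_iff two_ne_zero |>.1 ((mul_eq_zero.1 h4).resolve_left h5)
  have hgz : EqOn g (fun _ => 0) (Icc a b) := by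
    rw [← closure_Ioo hab.ne] at hg ⊢
    exact EqOn.of_subset_closure (fun x hx => (hint x hx).1) hg continuousOn_const
      subset_closure le_rfl
  intro x hx
  refine ⟨hgz hx, ?_⟩
  rcases eq_or_lt_of_le hx.1 with rfl | h1
  · exact hya
  rcases eq_or_lt_of_le hx.2 with rfl | h2
  · exact hyb
  exact (hint x ⟨h1, h2⟩).2

/-- The system `y' = β g`, `r g' = (r + κ) y - k` with `k > 0` has no solution satisfying
`y a = y b = g b = 0`. -/
theorem electrode_flux_not_pos {a b κ k : ℝ} {r β g y : ℝ → ℝ} (hab : a < b) (hκ : 0 < κ)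
    (hk : 0 < k) (hrc : ContinuousOn r (Icc a b))
    (hr : ∀ x ∈ Icc a b, 0 < r x) (hβ : ∀ x ∈ Icc a b, 0 < β x)
    (hg : ContinuousOn g (Icc a b)) (hy : ContinuousOn y (Icc a b))
    (hy' : ∀ x ∈ Ioo a b, HasDerivAt y (β x * g x) x)
    (hg' : ∀ x ∈ Ioo a b, HasDerivAt g (((r x + κ) * y x - k) / r x) x)
    (hya : y a = 0) (hyb : y b = 0) (hgb : g b = 0) : False := by
  have hanti : ∀ s, a ≤ s → (∀ x ∈ Ioo s b, (r x + κ) * y x - k < 0) →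
      StrictAntiOn g (Icc s b) := by
    intro s has hneg
    refine strictAntiOn_of_hasDerivWithinAt_neg (convex_Icc s b)
      (hg.mono (Icc_subset_Icc_left has)) (f' := fun x => ((r x + κ) * y x - k) / r x) ?_ ?_
    · intro x hx
      rw [interior_Icc] at hx
      exact (hg' x ⟨has.trans_lt hx.1, hx.2⟩).hasDerivWithinAt
    · intro x hx
      rw [interior_Icc] at hx
      exact div_neg_of_neg_of_pos (hneg x hx) (hr x ⟨has.trans hx.1.le, hx.2.le⟩)
  have hmono : ∀ s, a ≤ s → (∀ x ∈ Ioo s b, 0 < g x) → StrictMonoOn y (Icc s b) := by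
    intro s has hpos
    refine strictMonoOn_of_hasDerivWithinAt_pos (convex_Icc s b)
      (hy.mono (Icc_subset_Icc_left has)) (f' := fun x => β x * g x) ?_ ?_
    · intro x hx
      rw [interior_Icc] at hx
      exact (hy' x ⟨has.trans_lt hx.1, hx.2⟩).hasDerivWithinAt
    · intro x hx
      rw [interior_Icc] at hx
      exact mul_pos (hβ x ⟨has.trans hx.1.le, hx.2.le⟩) (hpos x hx)
  obtain ⟨s, has, hsb, hs⟩ : ∃ s, a ≤ s ∧ s < b ∧ ∀ x ∈ Ioo s b, (r x + κ) * y x - k < 0 := by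
    have hD : ContinuousWithinAt (fun x => (r x + κ) * y x - k) (Icc a b) b :=
      (((hrc.add continuousOn_const).mul hy).sub continuousOn_const) b (right_mem_Icc.2 hab.le)
    have hlim : ∀ᶠ x in nhdsWithin b (Iio b), (r x + κ) * y x - k < 0 := by
      have h1 : ∀ᶠ x in nhdsWithin b (Icc a b), (r x + κ) * y x - k < 0 :=
        hD.eventually_lt_const (by simp [hyb, hk])
      rw [← nhdsWithin_Ioo_eq_nhdsLT hab]
      exact h1.filter_mono (nhdsWithin_mono _ Ioo_subset_Icc_self)
    obtain ⟨s, hs, hsub⟩ := (mem_nhdsLT_iff_exists_mem_Ico_Ioo_subset hab).1 hlim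
    exact ⟨s, hs.1, hs.2, fun x hx => hsub hx⟩
  have hpos_near : ∀ x ∈ Ico s b, 0 < g x := by
    intro x hx
    have := hanti s has hs ⟨hx.1, hx.2.le⟩ (right_mem_Icc.2 hsb.le) hx.2
    rwa [hgb] at this
  have hpos : ∀ x ∈ Ico a b, 0 < g x := by
    by_contra! hex
    obtain ⟨x₀, hx₀, hgx₀⟩ := hex
    have hx₀s : x₀ ≤ s := by
      by_contra! h
      exact absurd (hpos_near x₀ ⟨h.le, hx₀.2⟩) hgx₀.not_gt
    have hcomp : IsCompact (Icc a s ∩ g ⁻¹' Iic 0) :=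
      isCompact_Icc.of_isClosed_subset
        ((hg.mono (Icc_subset_Icc_right hsb.le)).preimage_isClosed_of_isClosed isClosed_Icc
          isClosed_Iic) inter_subset_left
    obtain ⟨m, ⟨hm, hgm⟩, hmax⟩ := hcomp.exists_isGreatest ⟨x₀, ⟨hx₀.1, hx₀s⟩, hgx₀⟩
    have hmb : m < b := hm.2.trans_lt hsb
    have hgpos : ∀ x ∈ Ioo m b, 0 < g x := by
      intro x hx
      by_contra! h
      rcases le_or_gt x s with hxs | hxs
      · exact absurd (hmax ⟨⟨hm.1.trans hx.1.le, hxs⟩, h⟩) hx.1.not_ge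
      · exact absurd (hpos_near x ⟨hxs.le, hx.2⟩) h.not_gt
    have hlt := hanti m hm.1 (fun x hx => by
      have hyx := hmono m hm.1 hgpos ⟨hx.1.le, hx.2.le⟩ (right_mem_Icc.2 hmb.le) hx.2
      rw [hyb] at hyx
      have := hr x ⟨hm.1.trans hx.1.le, hx.2.le⟩
      nlinarith) (left_mem_Icc.2 hmb.le) (right_mem_Icc.2 hmb.le) hmb
    rw [hgb] at hlt
    exact absurd hlt (not_lt.2 hgm)
  have := hmono a le_rfl (fun x hx => hpos x ⟨hx.1.le, hx.2⟩) (left_mem_Icc.2 hab.le)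
    (right_mem_Icc.2 hab.le) hab
  rw [hya, hyb] at this
  exact lt_irrefl _ this

/-- The system `y' = β g`, `r g' = (r + κ) y - k` with `y a = y b = g b = 0` forces `k = 0`. -/
theorem electrode_flux_eq_zero {a b κ k : ℝ} {r β g y : ℝ → ℝ} (hab : a < b) (hκ : 0 < κ)
    (hrc : ContinuousOn r (Icc a b))
    (hr : ∀ x ∈ Icc a b, 0 < r x) (hβ : ∀ x ∈ Icc a b, 0 < β x)
    (hg : ContinuousOn g (Icc a b)) (hy : ContinuousOn y (Icc a b))
    (hy' : ∀ x ∈ Ioo a b, HasDerivAt y (β x * g x) x)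
    (hg' : ∀ x ∈ Ioo a b, HasDerivAt g (((r x + κ) * y x - k) / r x) x)
    (hya : y a = 0) (hyb : y b = 0) (hgb : g b = 0) : k = 0 := by
  rcases lt_trichotomy k 0 with hk | hk | hk
  · refine (electrode_flux_not_pos (g := fun x => -g x) (y := fun x => -y x) (k := -k) hab hκ
      (neg_pos.2 hk) hrc hr hβ hg.neg hy.neg (fun x hx => ?_) (fun x hx => ?_)
      (by simp [hya]) (by simp [hyb]) (by simp [hgb])).elim
    · refine HasDerivAt.congr_deriv ((hy' x hx).fun_neg) ?_
      ring
    · refine HasDerivAt.congr_deriv ((hg' x hx).fun_neg) ?_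
      ring
  · exact hk
  · exact (electrode_flux_not_pos hab hκ hk hrc hr hβ hg hy hy' hg' hya hyb hgb).elim

/-- If `h` is differentiable at `b`, constant on `[b, c]`, and its derivative on `(a, b)` is a
function `φ` continuous on `[a, b]`, then `φ b = 0`. -/
theorem eq_zero_of_hasDerivAt_of_const_right {h φ : ℝ → ℝ} {a b c : ℝ} (hab : a < b) (hbc : b < c)
    (hd : DifferentiableAt ℝ h b) (hder : ∀ x ∈ Ioo a b, HasDerivAt h (φ x) x)
    (hφ : ContinuousOn φ (Icc a b)) (hconst : ∀ x ∈ Icc b c, h x = h b) : φ b = 0 := by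
  have hleft : HasDerivWithinAt h (φ b) (Iic b) b := by
    refine hasDerivWithinAt_Iic_of_tendsto_deriv (s := Ioo a b)
      (fun x hx => (hder x hx).differentiableAt.differentiableWithinAt)
      hd.continuousAt.continuousWithinAt (Ioo_mem_nhdsLT hab) ?_
    have hlim : Filter.Tendsto φ (nhdsWithin b (Iio b)) (nhds (φ b)) := by
      rw [← nhdsWithin_Ioo_eq_nhdsLT hab]
      exact (hφ b (right_mem_Icc.2 hab.le)).mono Ioo_subset_Icc_self
    refine hlim.congr' ?_
    filter_upwards [Ioo_mem_nhdsLT hab] with x hx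
    exact (hder x hx).deriv.symm
  have hright : HasDerivWithinAt h 0 (Icc b c) b :=
    (hasDerivWithinAt_const b (Icc b c) (h b)).congr hconst rfl
  have h1 := (uniqueDiffWithinAt_Iic b).eq_deriv _ hleft hd.hasDerivAt.hasDerivWithinAt
  have h2 := (uniqueDiffOn_Icc hbc b (left_mem_Icc.2 hbc.le)).eq_deriv _ hright
    hd.hasDerivAt.hasDerivWithinAt
  rw [h1, ← h2]

/-- On an interior interval, the flux equations determine the derivative of the difference
`r u₂' - r u₁'`. -/
theorem hasDerivAt_flux_diff {L ν x F₁ F₂ : ℝ} {r c u₁ u₂ : ℝ → ℝ} (hx : x ∈ Ioo 0 L)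
    (hrlc : DifferentiableOn ℝ (fun y => r y * deriv c y / c y) (Ioo 0 L))
    (h₁ : DifferentiableOn ℝ (fun y => r y * deriv u₁ y) (Ioo 0 L))
    (h₂ : DifferentiableOn ℝ (fun y => r y * deriv u₂ y) (Ioo 0 L))
    (hF₁ : deriv (flux r c ν u₁) x = F₁) (hF₂ : deriv (flux r c ν u₂) x = F₂) :
    HasDerivAt (fun y => r y * derivWithin u₂ (Icc 0 L) y - r y * derivWithin u₁ (Icc 0 L) y)
      (F₁ - F₂) x := by
  have hn := isOpen_Ioo.mem_nhds hx
  have hd : ∀ u : ℝ → ℝ, DifferentiableOn ℝ (fun y => r y * deriv u y) (Ioo 0 L) →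
      HasDerivAt (flux r c ν u) (deriv (flux r c ν u) x) x := fun u hu =>
    (((hu.differentiableAt hn).fun_neg).fun_add
      ((hrlc.differentiableAt hn).const_mul ν)).hasDerivAt
  have h := (hd u₁ h₁).fun_sub (hd u₂ h₂)
  rw [hF₁, hF₂] at h
  refine h.congr_of_eventuallyEq ?_
  filter_upwards [hn] with y hy
  rw [derivWithin_of_mem_nhds (Icc_mem_nhds hy.1 hy.2),
    derivWithin_of_mem_nhds (Icc_mem_nhds hy.1 hy.2)]
  simp only [flux]
  ring

theorem uniqueness_up_to_constant_lin (L₁ δ L ν dm dp lm lp tm tp : ℝ) (f r c bm bp : ℝ → ℝ) (u₁ v₁ u₂ v₂ : ℝ → ℝ)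
    (hL₁ : 0 < L₁) (hδ : 0 < δ) (hL : L₁ + δ < L)
    (hf : Continuous f)
    (hr : ContDiffOn ℝ 1 r (Icc 0 L)) (hrpos : ∀ x ∈ Icc 0 L, 0 < r x)
    (hc : ContDiffOn ℝ 1 c (Icc 0 L)) (hcpos : ∀ x ∈ Icc 0 L, 0 < c x)
    (hc0 : deriv c 0 = 0) (hcL : deriv c L = 0)
    (hrlc : DifferentiableOn ℝ (fun y => r y * deriv c y / c y) (Ioo 0 L))
    (hbm : ContinuousOn bm (Icc 0 L₁)) (hbmpos : ∀ x ∈ Icc 0 L₁, 0 < bm x)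
    (hbp : ContinuousOn bp (Icc (L₁ + δ) L)) (hbppos : ∀ x ∈ Icc (L₁ + δ) L, 0 < bp x)
    (hlm : 0 < lm) (hlp : 0 < lp) (htm : 0 < tm) (htp : 0 < tp)
    (hsol₁ : IsSolutionLin L₁ δ L ν dm dp lm lp tm tp f r c bm bp u₁ v₁)
    (hsol₂ : IsSolutionLin L₁ δ L ν dm dp lm lp tm tp f r c bm bp u₂ v₂) :
    ∃ s : ℝ, (∀ x ∈ Icc (0:ℝ) L, u₂ x - u₁ x = s) ∧
      (∀ x ∈ Icc (0:ℝ) L₁, v₂ x - v₁ x = s) ∧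
      (∀ x ∈ Icc (L₁ + δ) L, v₂ x - v₁ x = s) := by
  obtain ⟨hu₁, hru₁, hv₁, hm₁, hs₁, hp₁, -, -, hvm₁, hvp₁, ha₁, hb₁, hc₁, hd₁⟩ := hsol₁
  obtain ⟨hu₂, hru₂, hv₂, hm₂, hs₂, hp₂, -, -, hvm₂, hvp₂, ha₂, hb₂, hc₂, hd₂⟩ := hsol₂
  have hL0 : 0 < L := by linarith
  have hsubm : Icc 0 L₁ ⊆ Icc 0 L := Icc_subset_Icc_right (by linarith)
  have hsubs : Icc L₁ (L₁ + δ) ⊆ Icc 0 L := Icc_subset_Icc hL₁.le hL.le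
  have hsubp : Icc (L₁ + δ) L ⊆ Icc 0 L := Icc_subset_Icc_left (by linarith)
  set w : ℝ → ℝ := fun x => u₂ x - u₁ x with hw
  set g : ℝ → ℝ := fun x => v₂ x - v₁ x - w x with hg
  set y : ℝ → ℝ := fun x => deriv v₂ x - deriv v₁ x with hy
  set p : ℝ → ℝ :=
    fun x => r x * derivWithin u₂ (Icc 0 L) x - r x * derivWithin u₁ (Icc 0 L) x with hp
  have hpc : ContinuousOn p (Icc 0 L) :=
    (hr.continuousOn.mul (hu₂.continuousOn_derivWithin (uniqueDiffOn_Icc hL0) le_rfl)).sub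
      (hr.continuousOn.mul (hu₁.continuousOn_derivWithin (uniqueDiffOn_Icc hL0) le_rfl))
  have hwc : ContinuousOn w (Icc 0 L) := hu₂.continuousOn.sub hu₁.continuousOn
  have hwd : ∀ x ∈ Ioo 0 L, HasDerivAt w (p x / r x) x := by
    intro x hx
    have hn := Icc_mem_nhds hx.1 hx.2
    have h1 := ((hu₁.differentiableOn one_ne_zero).differentiableAt hn).hasDerivAt
    have h2 := ((hu₂.differentiableOn one_ne_zero).differentiableAt hn).hasDerivAt
    refine HasDerivAt.congr_deriv (h2.fun_sub h1) ?_
    have := (hrpos x (Ioo_subset_Icc_self hx)).ne'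
    simp only [hp, derivWithin_of_mem_nhds hn]
    field_simp
  have hzd : ∀ x ∈ Icc 0 L₁ ∪ Icc (L₁ + δ) L, HasDerivAt (fun x => v₂ x - v₁ x) (y x) x :=
    fun x hx => (hv₂ x hx).1.hasDerivAt.fun_sub (hv₁ x hx).1.hasDerivAt
  have hyd : ∀ x ∈ Icc 0 L₁ ∪ Icc (L₁ + δ) L,
      HasDerivAt y (deriv (deriv v₂) x - deriv (deriv v₁) x) x :=
    fun x hx => (hv₂ x hx).2.hasDerivAt.fun_sub (hv₁ x hx).2.hasDerivAt
  have hpm : ∀ x ∈ Ioo 0 L₁, HasDerivAt p (-(lm * bm x * g x)) x := by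
    intro x hx
    refine HasDerivAt.congr_deriv
      (hasDerivAt_flux_diff ⟨hx.1, by linarith [hx.2]⟩ hrlc hru₁ hru₂
        (hm₁ x hx) (hm₂ x hx)) ?_
    simp only [hg, hw]
    ring
  have hps : ∀ x ∈ Ioo L₁ (L₁ + δ), HasDerivAt p 0 x := by
    intro x hx
    refine HasDerivAt.congr_deriv
      (hasDerivAt_flux_diff ⟨by linarith [hx.1], by linarith [hx.2]⟩ hrlc hru₁ hru₂
      (hs₁ x hx) (hs₂ x hx)) ?_
    ring
  have hpp : ∀ x ∈ Ioo (L₁ + δ) L, HasDerivAt p (-(lp * bp x * g x)) x := by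
    intro x hx
    refine HasDerivAt.congr_deriv
      (hasDerivAt_flux_diff ⟨by linarith [hx.1], hx.2⟩ hrlc hru₁ hru₂
        (hp₁ x hx) (hp₂ x hx)) ?_
    simp only [hg, hw]
    ring
  have hym : ∀ x ∈ Ioo 0 L₁, HasDerivAt y (tm * bm x * g x) x := by
    intro x hx
    refine HasDerivAt.congr_deriv (hyd x (Or.inl (Ioo_subset_Icc_self hx))) ?_
    rw [hvm₁ x hx, hvm₂ x hx]
    simp only [hg, hw]
    ring
  have hyp : ∀ x ∈ Ioo (L₁ + δ) L, HasDerivAt y (tp * bp x * g x) x := by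
    intro x hx
    refine HasDerivAt.congr_deriv (hyd x (Or.inr (Ioo_subset_Icc_self hx))) ?_
    rw [hvp₁ x hx, hvp₂ x hx]
    simp only [hg, hw]
    ring
  have hycm : ContinuousOn y (Icc 0 L₁) :=
    fun x hx => (hyd x (Or.inl hx)).continuousAt.continuousWithinAt
  have hycp : ContinuousOn y (Icc (L₁ + δ) L) :=
    fun x hx => (hyd x (Or.inr hx)).continuousAt.continuousWithinAt
  have hgcm : ContinuousOn g (Icc 0 L₁) := ContinuousOn.sub
    (fun x hx => (hzd x (Or.inl hx)).continuousAt.continuousWithinAt) (hwc.mono hsubm)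
  have hgcp : ContinuousOn g (Icc (L₁ + δ) L) := ContinuousOn.sub
    (fun x hx => (hzd x (Or.inr hx)).continuousAt.continuousWithinAt) (hwc.mono hsubp)
  have hy0 : y 0 = 0 := by simp [hy, ha₁, ha₂]
  have hyL₁ : y L₁ = 0 := by simp [hy, hc₁, hc₂]
  have hyLδ : y (L₁ + δ) = 0 := by simp [hy, hd₁, hd₂]
  have hyL : y L = 0 := by simp [hy, hb₁, hb₂]
  have hpsc : ∀ x ∈ Icc L₁ (L₁ + δ), p x = p L₁ := fun x hx =>
    eq_of_hasDerivAt_zero_Ioo (hpc.mono hsubs) hps x hx L₁ (left_mem_Icc.2 (by linarith))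
  have hgL₁ : g L₁ = 0 := by
    have hL₁L : L₁ ∈ Ioo 0 L := ⟨hL₁, by linarith⟩
    have hpd : DifferentiableAt ℝ p L₁ :=
      (hasDerivAt_flux_diff (ν := ν) hL₁L hrlc hru₁ hru₂ rfl rfl).differentiableAt
    have h0 := eq_zero_of_hasDerivAt_of_const_right hL₁ (by linarith : L₁ < L₁ + δ) hpd hpm
      ((continuousOn_const.mul hbm).mul hgcm).neg hpsc
    have hb := hbmpos L₁ (right_mem_Icc.2 hL₁.le)
    simpa [hlm.ne', hb.ne'] using h0
  have hpym : ∀ x ∈ Icc 0 L₁, p x = p L₁ - lm / tm * y x := by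
    intro x hx
    have h := eq_of_hasDerivAt_zero_Ioo (h := fun x => p x + lm / tm * y x)
      ((hpc.mono hsubm).add (continuousOn_const.mul hycm))
      (fun x hx => by
        refine HasDerivAt.congr_deriv ((hpm x hx).fun_add ((hym x hx).const_mul (lm / tm))) ?_
        field_simp
        ring) x hx L₁ (right_mem_Icc.2 hL₁.le)
    simp only [hyL₁] at h
    linarith
  have hgm : ∀ x ∈ Ioo 0 L₁, HasDerivAt g (((r x + lm / tm) * y x - p L₁) / r x) x := by
    intro x hx
    have hx' := Ioo_subset_Icc_self hx
    refine HasDerivAt.congr_deriv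
        ((hzd x (Or.inl hx')).fun_sub (hwd x ⟨hx.1, by linarith [hx.2]⟩)) ?_
    have := (hrpos x (hsubm hx')).ne'
    rw [hpym x hx']
    field_simp
    ring
  have hk : p L₁ = 0 :=
    electrode_flux_eq_zero (β := fun x => tm * bm x) hL₁ (div_pos hlm htm)
      (hr.continuousOn.mono hsubm) (fun x hx => hrpos x (hsubm hx))
      (fun x hx => mul_pos htm (hbmpos x hx)) hgcm hycm hym hgm hy0 hyL₁ hgL₁
  have hzm := electrode_eq_zero (β := fun x => tm * bm x) hL₁ (div_pos hlm htm)
    (fun x hx => hrpos x (hsubm hx)) (fun x hx => mul_pos htm (hbmpos x hx)) hgcm hycm hym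
    (by simpa only [hk, sub_zero] using hgm) hy0 hyL₁
  have hpyp : ∀ x ∈ Icc (L₁ + δ) L, p x = -(lp / tp * y x) := by
    intro x hx
    have h := eq_of_hasDerivAt_zero_Ioo (h := fun x => p x + lp / tp * y x)
      ((hpc.mono hsubp).add (continuousOn_const.mul hycp))
      (fun x hx => by
        refine HasDerivAt.congr_deriv ((hpp x hx).fun_add ((hyp x hx).const_mul (lp / tp))) ?_
        field_simp
        ring) x hx (L₁ + δ) (left_mem_Icc.2 hL.le)
    simp only [hyLδ, hpsc _ (right_mem_Icc.2 (by linarith : L₁ ≤ L₁ + δ)), hk] at h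
    linarith
  have hzp := electrode_eq_zero (β := fun x => tp * bp x) hL (div_pos hlp htp)
    (fun x hx => hrpos x (hsubp hx)) (fun x hx => mul_pos htp (hbppos x hx)) hgcp hycp hyp
    (fun x hx => by
      have hx' := Ioo_subset_Icc_self hx
      refine HasDerivAt.congr_deriv
        ((hzd x (Or.inr hx')).fun_sub (hwd x ⟨by linarith [hx.1], hx.2⟩)) ?_
      have := (hrpos x (hsubp hx')).ne'
      rw [hpyp x hx']
      field_simp
      ring) hyLδ hyL
  have hp0 : ∀ x ∈ Icc 0 L, p x = 0 := by
    intro x hx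
    rcases le_total x L₁ with h1 | h1
    · rw [hpym x ⟨hx.1, h1⟩, hk, (hzm x ⟨hx.1, h1⟩).2]
      ring
    rcases le_total x (L₁ + δ) with h2 | h2
    · rw [hpsc x ⟨h1, h2⟩, hk]
    · rw [hpyp x ⟨h2, hx.2⟩, (hzp x ⟨h2, hx.2⟩).2]
      ring
  have hwconst : ∀ x ∈ Icc 0 L, w x = w 0 := fun x hx =>
    eq_of_hasDerivAt_zero_Ioo hwc
      (fun x hx => by simpa [hp0 x (Ioo_subset_Icc_self hx)] using hwd x hx)
      x hx 0 (left_mem_Icc.2 hL0.le)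
  refine ⟨w 0, hwconst, fun x hx => ?_, fun x hx => ?_⟩
  · rw [← hwconst x (hsubm hx)]
    exact sub_eq_zero.1 (hzm x hx).1
  · rw [← hwconst x (hsubp hx)]
    exact sub_eq_zero.1 (hzp x hx).1
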